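/- Let ε > 0 and let 𝓛 = {L_i}_{i∈ℕ} be a countable collection of infinite subsets of ℕ such that L_a ∩ L_b is finite for all a ≠ b. Then there exists a prefix-causal map A from input streams to probability measures on index streams that is ε-differentially private in the continual release model and identifies 𝓛 in the limit on duplicate-free streams: for every index i and every injective enumeration e of L_i (e injective with range equal to L_i), A(e)({w : there exists n* such that for all n ≥ n*, L_{w(n)} = L_i}) = 1. -/

import Mathlib

open MeasureTheory

/-- Two streams are neighboring if they differ in exactly one coordinate. -/
def Neighboring (x x' : ℕ → ℕ) : Prop :=
  ∃ j, x j ≠ x' j ∧ ∀ m, m ≠ j → x m = x' m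

/-- A continual-release algorithm is prefix-causal if streams agreeing on their
first `n` coordinates induce the same distribution on the first `n` outputs. -/
def PrefixCausal (A : (ℕ → ℕ) → Measure (ℕ → ℕ)) : Prop :=
  ∀ x x' : ℕ → ℕ, ∀ n : ℕ, (∀ m < n, x m = x' m) →
    (A x).map (fun w (m : Fin n) => w m.val) = (A x').map (fun w (m : Fin n) => w m.val)

/-- ε-differential privacy in the continual release model. -/
def DPCR (ε : ℝ) (A : (ℕ → ℕ) → Measure (ℕ → ℕ)) : Prop :=
  ∀ x x' : ℕ → ℕ, Neighboring x x' → ∀ E : Set (ℕ → ℕ), MeasurableSet E →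
    A x E ≤ ENNReal.ofReal (Real.exp ε) * A x' E

/-- An enumeration of a language `K`. -/
def IsEnumeration (K : Set ℕ) (e : ℕ → ℕ) : Prop :=
  (∀ n, e n ∈ K) ∧ ∀ y ∈ K, ∃ n, e n = y

open scoped ENNReal

/-- Outer regularity reduces comparison of measures on Baire space to comparison of cylinders. -/
theorem measure_le_mul_of_cylinder_le {P Q : Measure (ℕ → ℕ)} [IsFiniteMeasure Q]
    {C : ℝ≥0∞} (hC : C ≠ ∞)
    (h : ∀ (N : ℕ) (u : ℕ → ℕ), P {w | ∀ k < N, w k = u k} ≤ C * Q {w | ∀ k < N, w k = u k})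
    (E : Set (ℕ → ℕ)) : P E ≤ C * Q E := by
  have meas_cyl (N : ℕ) (u : ℕ → ℕ) : MeasurableSet {w : ℕ → ℕ | ∀ k < N, w k = u k} := by
    have : {w : ℕ → ℕ | ∀ k < N, w k = u k} = ⋂ k, ⋂ (_ : k < N), (fun w => w k) ⁻¹' {u k} := by
      ext; simp
    rw [this]
    exact .iInter fun k => .iInter fun _ => measurable_pi_apply k (measurableSet_singleton _)
  have hopen (U : Set (ℕ → ℕ)) (hU : IsOpen U) : P U ≤ C * Q U := by
    let V : ℕ → Set (ℕ → ℕ) := fun N => {u | ∀ w : ℕ → ℕ, (∀ k < N, w k = u k) → w ∈ U}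
    have hV : ⋃ N, V N = U := by
      ext u
      simp only [Set.mem_iUnion]
      refine ⟨fun ⟨N, hN⟩ => hN u fun _ _ => rfl, fun hu => ?_⟩
      obtain ⟨I, t, hI, hIU⟩ := isOpen_pi_iff.1 hU u hu
      refine ⟨I.sup id + 1, fun w hw => hIU fun k hk => ?_⟩
      rw [hw k (Nat.lt_succ_of_le (Finset.le_sup (f := id) hk))]
      exact (hI k hk).2
    have hmono : Monotone V := fun M N hMN u hu w hw => hu w fun k hk => hw k (hk.trans_le hMN)
    have hcyl (N : ℕ) : P (V N) ≤ C * Q (V N) := by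
      let f : (ℕ → ℕ) → Fin N → ℕ := fun w k => w k
      have hf : Measurable f := measurable_pi_lambda _ fun k => measurable_pi_apply _
      have hpre : V N = f ⁻¹' (f '' V N) := by
        refine (Set.subset_preimage_image f _).antisymm ?_
        rintro w ⟨u, hu, huw⟩ v hv
        exact hu v fun k hk => (hv k hk).trans (congrFun huw ⟨k, hk⟩).symm
      have hle : P.map f ≤ C • Q.map f := by
        refine Measure.le_iff.2 fun s _ => ?_
        rw [Measure.smul_apply, smul_eq_mul, ← Measure.tsum_indicator_apply_singleton (P.map f) s
          s.to_countable.measurableSet, ← Measure.tsum_indicator_apply_singleton (Q.map f) s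
          s.to_countable.measurableSet, ← ENNReal.tsum_mul_left]
        refine ENNReal.tsum_le_tsum fun a => ?_
        by_cases ha : a ∈ s
        · simp only [Set.indicator_of_mem ha]
          rw [Measure.map_apply hf (measurableSet_singleton a),
            Measure.map_apply hf (measurableSet_singleton a)]
          have : f ⁻¹' {a} = {w | ∀ k < N, w k = (fun k => if hk : k < N then a ⟨k, hk⟩ else 0) k} := by
            ext w
            simp only [Set.mem_preimage, Set.mem_singleton_iff, Set.mem_ofPred_eq, funext_iff, f]
            constructor
            · intro hw k hk
              simpa [hk] using hw ⟨k, hk⟩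
            · intro hw k
              simpa using hw k k.2
          rw [this]
          exact h N _
        · simp [ha]
      have := hle (f '' V N)
      rw [Measure.smul_apply, smul_eq_mul, Measure.map_apply hf (Set.to_countable _).measurableSet,
        Measure.map_apply hf (Set.to_countable _).measurableSet, ← hpre] at this
      exact this
    rw [← hV, hmono.measure_iUnion]
    exact iSup_le fun N => (hcyl N).trans (by gcongr; exact Set.subset_iUnion V N)
  rcases eq_or_ne C 0 with rfl | hC0
  · exact (measure_mono (Set.subset_univ E)).trans ((hopen _ isOpen_univ).trans (by simp))
  · rw [Set.measure_eq_iInf_isOpen E Q]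
    simp only [ENNReal.mul_iInf_of_ne hC0 hC]
    exact le_iInf fun U => le_iInf fun hEU => le_iInf fun hU => (measure_mono hEU).trans (hopen U hU)

theorem infinitePi_le_mul {μ ν : ℕ → Measure ℕ} [∀ k, IsProbabilityMeasure (μ k)]
    [∀ k, IsProbabilityMeasure (ν k)] {c : ℕ → ℝ≥0∞} {C : ℝ≥0∞} (hC : C ≠ ∞)
    (hμν : ∀ k, μ k ≤ c k • ν k) (hc : ∀ N, ∏ k ∈ Finset.range N, c k ≤ C) (E : Set (ℕ → ℕ)) :
    Measure.infinitePi μ E ≤ C * Measure.infinitePi ν E := by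
  refine measure_le_mul_of_cylinder_le hC (fun N u => ?_) E
  have hset : {w : ℕ → ℕ | ∀ k < N, w k = u k} =
      Set.pi (Finset.range N) fun k => ({u k} : Set ℕ) := by
    ext; simp [Set.mem_pi]
  rw [hset, Measure.infinitePi_pi _ fun _ _ => measurableSet_singleton _,
    Measure.infinitePi_pi _ fun _ _ => measurableSet_singleton _]
  calc ∏ k ∈ Finset.range N, μ k {u k} ≤ ∏ k ∈ Finset.range N, c k * ν k {u k} :=
        Finset.prod_le_prod' fun k _ => hμν k _
    _ ≤ _ := by rw [Finset.prod_mul_distrib]; gcongr; exact hc N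

/-- The exponential mechanism on the candidates `0, …, k` with scores `s`. -/
noncomputable def expMechanism (δ : ℝ) (k : ℕ) (s : ℕ → ℕ) : Measure ℕ :=
  ∑ j ∈ Finset.range (k + 1), ENNReal.ofReal
    (Real.exp (δ * s j) / ∑ l ∈ Finset.range (k + 1), Real.exp (δ * s l)) • Measure.dirac j

theorem sum_exp_pos (δ : ℝ) (k : ℕ) (s : ℕ → ℕ) :
    0 < ∑ l ∈ Finset.range (k + 1), Real.exp (δ * s l) :=
  Finset.sum_pos (fun _ _ => Real.exp_pos _) ⟨0, by simp⟩

instance (δ : ℝ) (k : ℕ) (s : ℕ → ℕ) : IsProbabilityMeasure (expMechanism δ k s) := by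
  constructor
  simp only [expMechanism, Measure.coe_finsetSum, Finset.sum_apply, Measure.smul_apply,
    measure_univ, smul_eq_mul, mul_one]
  rw [← ENNReal.ofReal_sum_of_nonneg, ← Finset.sum_div, div_self (sum_exp_pos δ k s).ne',
    ENNReal.ofReal_one]
  exact fun j _ => div_nonneg (Real.exp_pos _).le (sum_exp_pos δ k s).le

theorem expMechanism_le {δ : ℝ} (hδ : 0 ≤ δ) (k : ℕ) {s s' : ℕ → ℕ}
    (h : ∀ j, s j ≤ s' j + 1) (h' : ∀ j, s' j ≤ s j + 1) :
    expMechanism δ k s ≤ ENNReal.ofReal (Real.exp (2 * δ)) • expMechanism δ k s' := by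
  have step {a b : ℕ} (hab : a ≤ b + 1) : Real.exp (δ * a) ≤ Real.exp δ * Real.exp (δ * b) := by
    rw [← Real.exp_add]
    have : (a : ℝ) ≤ b + 1 := mod_cast hab
    gcongr
    nlinarith
  unfold expMechanism
  rw [Finset.smul_sum]
  refine Finset.sum_le_sum fun j _ => ?_
  rw [smul_smul, ← ENNReal.ofReal_mul (Real.exp_pos _).le]
  refine Measure.le_iff.2 fun E _ => ?_
  simp only [Measure.smul_apply, smul_eq_mul]
  gcongr
  rw [mul_div_assoc', div_le_div_iff₀ (sum_exp_pos δ k s) (sum_exp_pos δ k s')]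
  calc Real.exp (δ * s j) * ∑ l ∈ Finset.range (k + 1), Real.exp (δ * s' l)
      ≤ (Real.exp δ * Real.exp (δ * s' j)) *
          ∑ l ∈ Finset.range (k + 1), Real.exp δ * Real.exp (δ * s l) := by
        gcongr with l
        · exact step (h j)
        · exact step (h' l)
    _ = _ := by rw [← Finset.mul_sum, two_mul, Real.exp_add]; ring

theorem expMechanism_compl_le {δ : ℝ} (hδ : 0 ≤ δ) {k i T C : ℕ} (hi : i ≤ k) {s : ℕ → ℕ}
    (hsi : s i = T) (hs : ∀ j ≤ k, j ≠ i → s j ≤ C) :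
    expMechanism δ k s {i}ᶜ ≤ ENNReal.ofReal ((k + 1) * Real.exp (δ * C - δ * T)) := by
  have hW : Real.exp (δ * T) ≤ ∑ l ∈ Finset.range (k + 1), Real.exp (δ * s l) := by
    rw [← hsi]
    exact Finset.single_le_sum (f := fun l => Real.exp (δ * s l)) (fun _ _ => (Real.exp_pos _).le)
      (Finset.mem_range.2 (Nat.lt_succ_of_le hi))
  simp only [expMechanism, Measure.coe_finsetSum, Finset.sum_apply, Measure.smul_apply, smul_eq_mul]
  calc _ ≤ ∑ j ∈ Finset.range (k + 1), ENNReal.ofReal (Real.exp (δ * C - δ * T)) := by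
        refine Finset.sum_le_sum fun j hj => ?_
        by_cases hji : j = i
        · simp [hji]
        · refine (mul_le_of_le_one_right' prob_le_one).trans (ENNReal.ofReal_le_ofReal ?_)
          rw [Real.exp_sub]
          have : (s j : ℝ) ≤ C := mod_cast hs j (Nat.lt_succ_iff.1 (Finset.mem_range.1 hj)) hji
          gcongr
    _ = _ := by
        rw [Finset.sum_const, Finset.card_range, nsmul_eq_mul, ENNReal.ofReal_mul (by positivity)]
        congr 1
        norm_cast

open scoped Classical in
/-- The number of the first `T` stream elements that lie in `L j`. -/
noncomputable def hitCount (L : ℕ → Set ℕ) (x : ℕ → ℕ) (T j : ℕ) : ℕ :=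
  ((Finset.range T).filter fun m => x m ∈ L j).card

theorem hitCount_congr {L : ℕ → Set ℕ} {x x' : ℕ → ℕ} {T : ℕ} (h : ∀ m < T, x m = x' m) :
    hitCount L x T = hitCount L x' T := by
  classical
  funext j
  unfold hitCount
  congr 1
  exact Finset.filter_congr fun m hm => by rw [h m (Finset.mem_range.1 hm)]

theorem hitCount_le_add_one {L : ℕ → Set ℕ} {x x' : ℕ → ℕ} {p : ℕ} (h : ∀ m, m ≠ p → x m = x' m)
    (T j : ℕ) : hitCount L x T j ≤ hitCount L x' T j + 1 := by
  classical
  unfold hitCount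
  refine (Finset.card_le_card fun m hm => ?_).trans (Finset.card_insert_le p _)
  rw [Finset.mem_filter] at hm
  by_cases hmp : m = p
  · simp [hmp]
  · exact Finset.mem_insert_of_mem (Finset.mem_filter.2 ⟨hm.1, h m hmp ▸ hm.2⟩)

theorem hitCount_of_range_subset {L : ℕ → Set ℕ} {x : ℕ → ℕ} {i : ℕ} (h : Set.range x ⊆ L i)
    (T : ℕ) : hitCount L x T i = T := by
  classical
  unfold hitCount
  rw [Finset.filter_true_of_mem fun m _ => h ⟨m, rfl⟩, Finset.card_range]

theorem hitCount_le_ncard {L : ℕ → Set ℕ} {x : ℕ → ℕ} (hx : Function.Injective x) {i j : ℕ}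
    (h : Set.range x ⊆ L i) (hfin : (L i ∩ L j).Finite) (T : ℕ) :
    hitCount L x T j ≤ (L i ∩ L j).ncard := by
  classical
  unfold hitCount
  rw [← Finset.card_image_of_injective _ hx, ← Set.ncard_coe_finset]
  refine Set.ncard_le_ncard (fun y hy => ?_) hfin
  simp only [Finset.coe_image, Set.mem_image, Finset.mem_coe, Finset.mem_filter] at hy
  obtain ⟨m, hm, rfl⟩ := hy
  exact ⟨h ⟨m, rfl⟩, hm.2⟩

theorem exists_stage_length (δ : ℝ) (hδ : 0 < δ) (k C : ℕ) :
    ∃ T : ℕ, (k + 1) * Real.exp (δ * C - δ * T) ≤ (1 / 2 : ℝ) ^ k := by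
  have h : Filter.Tendsto (fun T : ℕ => (k + 1) * Real.exp (δ * C - δ * T)) Filter.atTop
      (nhds ((k + 1) * 0)) := by
    refine Filter.Tendsto.const_mul _ (Real.tendsto_exp_atBot.comp ?_)
    exact Filter.tendsto_atBot_add_const_left _ (δ * C)
      (Filter.tendsto_neg_atTop_atBot.comp (tendsto_natCast_atTop_atTop.const_mul_atTop hδ))
  rw [mul_zero] at h
  exact (h.eventually_le_const (by positivity)).exists

/-- The algorithm: at each time, output the sample of the latest stage already reached; stage `k`
is an independent exponential mechanism run on the first `T k` stream elements. -/
noncomputable def stagedMechanism (L : ℕ → Set ℕ) (δ : ℕ → ℝ) (T κ : ℕ → ℕ) (x : ℕ → ℕ) :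
    Measure (ℕ → ℕ) :=
  (Measure.infinitePi fun k => expMechanism (δ k) k (hitCount L x (T k))).map fun J n => J (κ n)

theorem measurable_reindex (κ : ℕ → ℕ) : Measurable fun (J : ℕ → ℕ) n => J (κ n) :=
  measurable_pi_lambda _ fun _ => measurable_pi_apply _

instance (L : ℕ → Set ℕ) (δ : ℕ → ℝ) (T κ x : ℕ → ℕ) :
    IsProbabilityMeasure (stagedMechanism L δ T κ x) :=
  Measure.isProbabilityMeasure_map (measurable_reindex κ).aemeasurable

theorem prefixCausal_stagedMechanism (L : ℕ → Set ℕ) (δ : ℕ → ℝ) {T κ : ℕ → ℕ}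
    (h : ∀ n, T (κ n) ≤ n) : PrefixCausal (stagedMechanism L δ T κ) := by
  intro x x' n hx
  let S : Finset ℕ := (Finset.range n).image κ
  have hS (m : Fin n) : κ m ∈ S := Finset.mem_image_of_mem _ (Finset.mem_range.2 m.2)
  let g : (S → ℕ) → Fin n → ℕ := fun J m => J ⟨κ m, hS m⟩
  have hg : Measurable g := measurable_pi_lambda _ fun _ => measurable_pi_apply _
  have key (y : ℕ → ℕ) : (stagedMechanism L δ T κ y).map (fun w (m : Fin n) => w m.val) =
      (Measure.pi fun k : S => expMechanism (δ k) k (hitCount L y (T k))).map g := by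
    rw [stagedMechanism, Measure.map_map
      (measurable_pi_lambda _ fun _ => measurable_pi_apply _) (measurable_reindex κ),
      ← Measure.infinitePi_map_restrict (μ := fun k => expMechanism (δ k) k (hitCount L y (T k))),
      Measure.map_map hg (Finset.measurable_restrict S)]
    rfl
  rw [key, key]
  congr! 3 with k
  congr 1
  obtain ⟨m, hm, hmk⟩ := Finset.mem_image.1 k.2
  refine hitCount_congr fun a ha => hx a ?_
  rw [← hmk] at ha
  exact (ha.trans_le (h m)).trans (Finset.mem_range.1 hm)

theorem dpcr_stagedMechanism (L : ℕ → Set ℕ) {ε : ℝ} {δ : ℕ → ℝ} (hδ : ∀ k, 0 ≤ δ k)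
    (hsum : ∀ N, ∑ k ∈ Finset.range N, 2 * δ k ≤ ε) (T κ : ℕ → ℕ) :
    DPCR ε (stagedMechanism L δ T κ) := by
  rintro x x' ⟨p, -, hp⟩ E hE
  rw [stagedMechanism, stagedMechanism, Measure.map_apply (measurable_reindex κ) hE,
    Measure.map_apply (measurable_reindex κ) hE]
  refine infinitePi_le_mul (c := fun k => ENNReal.ofReal (Real.exp (2 * δ k))) ENNReal.ofReal_ne_top
    (fun k => expMechanism_le (hδ k) k (hitCount_le_add_one hp _)
      (hitCount_le_add_one (fun m hm => (hp m hm).symm) _)) (fun N => ?_) _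
  rw [← ENNReal.ofReal_prod_of_nonneg fun _ _ => (Real.exp_pos _).le, ← Real.exp_sum]
  exact ENNReal.ofReal_le_ofReal (Real.exp_le_exp.2 (hsum N))

theorem stagedMechanism_identifies {L : ℕ → Set ℕ} {δ : ℕ → ℝ} {T κ e : ℕ → ℕ} {i : ℕ}
    (hκ : Filter.Tendsto κ Filter.atTop Filter.atTop)
    (h : ∀ k, expMechanism (δ k) k (hitCount L e (T k)) {i}ᶜ ≤ 2 ^ i * 2⁻¹ ^ k) :
    stagedMechanism L δ T κ e {w | ∃ nstar : ℕ, ∀ n ≥ nstar, L (w n) = L i} = 1 := by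
  have hmeas : MeasurableSet {w : ℕ → ℕ | ∃ nstar : ℕ, ∀ n ≥ nstar, L (w n) = L i} := by
    have : {w : ℕ → ℕ | ∃ nstar : ℕ, ∀ n ≥ nstar, L (w n) = L i} =
        ⋃ N, ⋂ n, ⋂ (_ : n ≥ N), (fun w => w n) ⁻¹' {a | L a = L i} := by
      ext; simp
    rw [this]
    exact .iUnion fun N => .iInter fun n => .iInter fun _ =>
      measurable_pi_apply n (Set.to_countable _).measurableSet
  rw [← mem_ae_iff_prob_eq_one hmeas]
  refine (ae_map_iff (measurable_reindex κ).aemeasurable hmeas).2 ?_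
  let P : Measure (ℕ → ℕ) :=
    Measure.infinitePi fun k => expMechanism (δ k) k (hitCount L e (T k))
  have herr (k : ℕ) : P ((fun J => J k) ⁻¹' {i}ᶜ) ≤ 2 ^ i * 2⁻¹ ^ k := by
    rw [← Measure.map_apply (measurable_pi_apply k) (measurableSet_singleton i).compl]
    simp only [P, Measure.infinitePi_map_eval]
    exact h k
  have hsum : ∑' k, P ((fun J => J k) ⁻¹' {i}ᶜ) ≠ ∞ := by
    refine ne_top_of_le_ne_top ?_ (ENNReal.tsum_le_tsum herr)
    rw [ENNReal.tsum_mul_left, ENNReal.tsum_geometric, ENNReal.one_sub_inv_two, inv_inv]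
    finiteness
  filter_upwards [ae_eventually_notMem hsum] with J hJ
  obtain ⟨N, hN⟩ := Filter.eventually_atTop.1 (hκ.eventually hJ)
  refine ⟨N, fun n hn => ?_⟩
  have : J (κ n) = i := by simpa using hN n hn
  rw [this]

/-- private identification with finite pairwise intersections:
If all pairs of distinct languages in the countable collection have finite
intersection, there is a prefix-causal ε-DP continual-release algorithm that
identifies the collection in the limit on duplicate-free streams. -/
theorem stmt12 (ε : ℝ) (hε : 0 < ε) (L : ℕ → Set ℕ) (hL : ∀ i, (L i).Infinite)
    (hFin : ∀ a b : ℕ, a ≠ b → (L a ∩ L b).Finite) :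
    ∃ A : (ℕ → ℕ) → Measure (ℕ → ℕ),
      (∀ x, IsProbabilityMeasure (A x)) ∧ PrefixCausal A ∧ DPCR ε A ∧
      ∀ i : ℕ, ∀ e : ℕ → ℕ, Function.Injective e → Set.range e = L i →
        A e {w | ∃ nstar : ℕ, ∀ n ≥ nstar, L (w n) = L i} = 1 := by
  let δ : ℕ → ℝ := fun k => ε / 4 * (1 / 2) ^ k
  have hδ (k : ℕ) : 0 < δ k := by positivity
  have hsum (N : ℕ) : ∑ k ∈ Finset.range N, 2 * δ k ≤ ε := by
    have : ∑ k ∈ Finset.range N, 2 * δ k = ε / 2 * ∑ k ∈ Finset.range N, (1 / 2 : ℝ) ^ k := by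
      rw [Finset.mul_sum]
      exact Finset.sum_congr rfl fun k _ => by simp only [δ]; ring
    rw [this]
    nlinarith [sum_geometric_two_le N]
  let C : ℕ → ℕ := fun k => ∑ a ∈ Finset.range (k + 1), ∑ b ∈ Finset.range (k + 1),
    (L a ∩ L b).ncard
  choose T₀ hT₀ using fun k => exists_stage_length (δ k) (hδ k) k (C k)
  let T : ℕ → ℕ := fun k => if k = 0 then 0 else T₀ k
  let κ : ℕ → ℕ := fun n => Nat.findGreatest (fun k => T k ≤ n) n
  have hκT (n : ℕ) : T (κ n) ≤ n :=
    Nat.findGreatest_spec (P := fun k => T k ≤ n) (Nat.zero_le n) (by simp [T])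
  have hκ : Filter.Tendsto κ Filter.atTop Filter.atTop := by
    refine Filter.tendsto_atTop.2 fun K => ?_
    filter_upwards [Filter.eventually_ge_atTop (max K (T K))] with n hn
    exact Nat.le_findGreatest ((le_max_left _ _).trans hn) ((le_max_right _ _).trans hn)
  refine ⟨stagedMechanism L δ T κ, inferInstance, prefixCausal_stagedMechanism L δ hκT,
    dpcr_stagedMechanism L (fun k => (hδ k).le) hsum T κ, fun i e he hrange => ?_⟩
  refine stagedMechanism_identifies hκ fun k => ?_
  by_cases hk : i ≤ k ∧ k ≠ 0
  · have hs : ∀ j ≤ k, j ≠ i → hitCount L e (T k) j ≤ C k := fun j hj hji =>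
      calc hitCount L e (T k) j ≤ (L i ∩ L j).ncard :=
            hitCount_le_ncard he hrange.subset (hFin i j hji.symm) _
        _ ≤ ∑ b ∈ Finset.range (k + 1), (L i ∩ L b).ncard :=
            Finset.single_le_sum (f := fun b => (L i ∩ L b).ncard) (fun _ _ => Nat.zero_le _)
              (Finset.mem_range.2 (Nat.lt_succ_of_le hj))
        _ ≤ C k :=
            Finset.single_le_sum (f := fun a => ∑ b ∈ Finset.range (k + 1), (L a ∩ L b).ncard)
              (fun _ _ => Nat.zero_le _) (Finset.mem_range.2 (Nat.lt_succ_of_le hk.1))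
    refine (expMechanism_compl_le (hδ k).le hk.1
      (hitCount_of_range_subset hrange.subset _) hs).trans ?_
    have hTk : T k = T₀ k := if_neg hk.2
    rw [hTk]
    refine (ENNReal.ofReal_le_ofReal (hT₀ k)).trans ?_
    rw [ENNReal.ofReal_pow (by norm_num), one_div, ENNReal.ofReal_inv_of_pos two_pos,
      ENNReal.ofReal_ofNat]
    exact le_mul_of_one_le_left' (one_le_pow₀ one_le_two)
  · have hki : k ≤ i := by omega
    refine prob_le_one.trans ?_
    calc (1 : ℝ≥0∞) = 2 ^ k * 2⁻¹ ^ k := by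
          rw [← mul_pow, ENNReal.mul_inv_cancel two_ne_zero ENNReal.ofNat_ne_top, one_pow]
      _ ≤ _ := by gcongr; exact one_le_two
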